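/- Let a₀ ∈ (0,1) be the unique zero of g(a) = −log((1 + √(1 − a²))/a) + 1/√(1 − a²). For every a with 0 < a < a₀ there exists η > 0 (with η < min(a, 1−a)) such that: x_a(t) > √(1 − a²) for all t with 1 − η ≤ t < 1, and x_a(t) < √(1 − a²) for all t with 1 < t ≤ 1 + η. -/

import Mathlib

/-- `g(a) = −log((1+√(1−a²))/a) + 1/√(1−a²)`. -/
noncomputable def gFun (a : ℝ) : ℝ :=
  -Real.log ((1 + Real.sqrt (1 - a ^ 2)) / a) + 1 / Real.sqrt (1 - a ^ 2)

/-- `x_a(t) = ∫_a^t ((x/(x²+t−t²))²−1)^{−1/2} dx`. -/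
noncomputable def xaFun (a t : ℝ) : ℝ :=
  ∫ x in a..t, 1 / Real.sqrt ((x / (x ^ 2 + t - t ^ 2)) ^ 2 - 1)

lemma g_neg (a₀ a : ℝ) (h₀ : a₀ ∈ Set.Ioo (0:ℝ) 1)
    (hz : gFun a₀ = 0) (ha0 : 0 < a) (ha : a < a₀) : gFun a < 0 := by
  obtain ⟨h1, h2⟩ := h₀
  rw [← hz]
  unfold gFun
  have hp : 0 < 1 - a₀ ^ 2 := by nlinarith
  have hlt : 1 - a₀ ^ 2 < 1 - a ^ 2 := by nlinarith
  have hs0 : 0 < Real.sqrt (1 - a₀ ^ 2) := Real.sqrt_pos.2 hp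
  have hs : Real.sqrt (1 - a₀ ^ 2) < Real.sqrt (1 - a ^ 2) := Real.sqrt_lt_sqrt hp.le hlt
  have e1 : 1 / Real.sqrt (1 - a ^ 2) < 1 / Real.sqrt (1 - a₀ ^ 2) :=
    one_div_lt_one_div_of_lt hs0 hs
  have e2 : Real.log ((1 + Real.sqrt (1 - a₀ ^ 2)) / a₀)
      < Real.log ((1 + Real.sqrt (1 - a ^ 2)) / a) := by
    apply Real.log_lt_log (by positivity)
    rw [div_lt_div_iff₀ h1 ha0]
    nlinarith
  linarith

noncomputable def FF (a t : ℝ) : ℝ :=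
  Real.sqrt (t ^ 2 - a ^ 2) + (1 - t) * (Real.log (t + Real.sqrt (t ^ 2 - a ^ 2)) - Real.log a)

noncomputable def PP (t x : ℝ) : ℝ := - FF x t

noncomputable def f0 (t x : ℝ) : ℝ := (x ^ 2 + t - t ^ 2) / (x * Real.sqrt (t ^ 2 - x ^ 2))

lemma PP_deriv (t x : ℝ) (hx : 0 < x) (hxt : x < t) : HasDerivAt (PP t) (f0 t x) x := by
  have hp : 0 < t ^ 2 - x ^ 2 := by nlinarith
  have hr : 0 < Real.sqrt (t ^ 2 - x ^ 2) := Real.sqrt_pos.2 hp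
  have hsq : Real.sqrt (t ^ 2 - x ^ 2) ^ 2 = t ^ 2 - x ^ 2 := Real.sq_sqrt hp.le
  have d0 : HasDerivAt (fun y : ℝ => t ^ 2 - y ^ 2) (-(2 * x)) x := by
    simpa using ((hasDerivAt_id x).pow 2).const_sub (t ^ 2)
  have d1 := d0.sqrt hp.ne'
  have htr : t + Real.sqrt (t ^ 2 - x ^ 2) ≠ 0 := ne_of_gt (by linarith)
  have d2 := (d1.const_add t).log htr
  have d3 := (d1.add ((d2.sub (Real.hasDerivAt_log hx.ne')).const_mul (1 - t))).neg
  refine d3.congr_deriv ?_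
  unfold f0
  set r := Real.sqrt (t ^ 2 - x ^ 2)
  field_simp
  have hx2 : x ^ 2 = t ^ 2 - r ^ 2 := by linarith
  grind

lemma PP_cont (a t : ℝ) (ha : 0 < a) (hat : a < t) : ContinuousOn (PP t) (Set.Icc a t) := by
  unfold PP FF
  have h1 : ∀ x ∈ Set.Icc a t, t + Real.sqrt (t ^ 2 - x ^ 2) ≠ 0 := by
    intro x hx
    have := Real.sqrt_nonneg (t ^ 2 - x ^ 2)
    have : 0 < t := ha.trans hat
    positivity
  have h2 : ∀ x ∈ Set.Icc a t, x ≠ 0 := fun x hx => (ha.trans_le hx.1).ne'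
  have c1 : ContinuousOn (fun x : ℝ => Real.sqrt (t ^ 2 - x ^ 2)) (Set.Icc a t) := by fun_prop
  exact (c1.add (continuousOn_const.mul (((continuousOn_const.add c1).log h1).sub
    (continuousOn_id.log h2)))).neg

lemma f0_nonneg (a t x : ℝ) (ha : 0 < a) (hc : 0 < a ^ 2 + t - t ^ 2) (hx : a < x) :
    0 ≤ f0 t x := by
  unfold f0
  have : 0 < x := ha.trans hx
  have : 0 ≤ x ^ 2 + t - t ^ 2 := by nlinarith
  positivity

lemma f0_int (a t : ℝ) (ha : 0 < a) (hat : a < t) (hc : 0 < a ^ 2 + t - t ^ 2) :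
    IntervalIntegrable (f0 t) MeasureTheory.volume a t := by
  rw [intervalIntegrable_iff_integrableOn_Ioc_of_le hat.le]
  exact intervalIntegral.integrableOn_deriv_of_nonneg (PP_cont a t ha hat)
    (fun x hx => PP_deriv t x (ha.trans hx.1) hx.2)
    (fun x hx => f0_nonneg a t x ha hc hx.1)

lemma f0_integral (a t : ℝ) (ha : 0 < a) (hat : a < t) (hc : 0 < a ^ 2 + t - t ^ 2) :
    ∫ x in a..t, f0 t x = FF a t := by
  rw [intervalIntegral.integral_eq_sub_of_hasDerivAt_of_le hat.le (PP_cont a t ha hat)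
    (fun x hx => PP_deriv t x (ha.trans hx.1) hx.2) (f0_int a t ha hat hc)]
  simp [PP, FF]

lemma integrand_bounds (a t x : ℝ) (ha : 0 < a) (hs : (1 - t) ^ 2 < a ^ 2)
    (hc : 0 < a ^ 2 + t - t ^ 2) (hx : a < x) (hxt : x < t) :
    f0 t x ≤ 1 / Real.sqrt ((x / (x ^ 2 + t - t ^ 2)) ^ 2 - 1) ∧
    1 / Real.sqrt ((x / (x ^ 2 + t - t ^ 2)) ^ 2 - 1)
      ≤ (1 / Real.sqrt (1 - (1 - t) ^ 2 / a ^ 2)) * f0 t x := by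
  have hx0 : 0 < x := ha.trans hx
  have hc' : 0 < x ^ 2 + t - t ^ 2 := by nlinarith
  have hp : 0 < t ^ 2 - x ^ 2 := by nlinarith
  have hq : 0 < x ^ 2 - (1 - t) ^ 2 := by nlinarith
  have hk : 0 < 1 - (1 - t) ^ 2 / a ^ 2 := by
    rw [sub_pos, div_lt_one (by positivity)]; exact hs
  have hA : (x / (x ^ 2 + t - t ^ 2)) ^ 2 - 1
      = (t ^ 2 - x ^ 2) * (x ^ 2 - (1 - t) ^ 2) / (x ^ 2 + t - t ^ 2) ^ 2 := by
    field_simp; ring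
  have hB : f0 t x = 1 / Real.sqrt ((t ^ 2 - x ^ 2) * x ^ 2 / (x ^ 2 + t - t ^ 2) ^ 2) := by
    unfold f0
    rw [Real.sqrt_div (by positivity), Real.sqrt_mul hp.le, Real.sqrt_sq hx0.le,
      Real.sqrt_sq hc'.le, one_div_div, mul_comm x]
  rw [hA, hB]
  constructor
  · apply one_div_le_one_div_of_le
    · apply Real.sqrt_pos.2; positivity
    · apply Real.sqrt_le_sqrt
      gcongr
      nlinarith [sq_nonneg (1 - t)]
  · rw [one_div_mul_one_div, ← Real.sqrt_mul hk.le]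
    apply one_div_le_one_div_of_le
    · apply Real.sqrt_pos.2; positivity
    · apply Real.sqrt_le_sqrt
      rw [← mul_div_assoc]
      gcongr ?_ / _
      have : (1 - (1 - t) ^ 2 / a ^ 2) * x ^ 2 ≤ x ^ 2 - (1 - t) ^ 2 := by
        have : (1 - t) ^ 2 ≤ (1 - t) ^ 2 / a ^ 2 * x ^ 2 := by
          rw [div_mul_eq_mul_div, le_div_iff₀ (by positivity)]
          gcongr
        linarith
      nlinarith

lemma xa_bounds (a t : ℝ) (ha : 0 < a) (hat : a < t) (hs : (1 - t) ^ 2 < a ^ 2)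
    (hc : 0 < a ^ 2 + t - t ^ 2) :
    FF a t ≤ xaFun a t ∧ xaFun a t ≤ (1 / Real.sqrt (1 - (1 - t) ^ 2 / a ^ 2)) * FF a t := by
  have i0 := f0_int a t ha hat hc
  have i1 := i0.const_mul (1 / Real.sqrt (1 - (1 - t) ^ 2 / a ^ 2))
  have hb := fun x (hx : x ∈ Set.Ioo a t) => integrand_bounds a t x ha hs hc hx.1 hx.2
  have i2 : IntervalIntegrable (fun x => 1 / Real.sqrt ((x / (x ^ 2 + t - t ^ 2)) ^ 2 - 1))
      MeasureTheory.volume a t := by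
    rw [intervalIntegrable_iff_integrableOn_Ioo_of_le hat.le] at i1 ⊢
    refine MeasureTheory.Integrable.mono' i1 ?_ ?_
    · apply Measurable.aestronglyMeasurable
      fun_prop
    · filter_upwards [MeasureTheory.ae_restrict_mem measurableSet_Ioo] with x hx
      rw [Real.norm_of_nonneg (by positivity)]
      exact (hb x hx).2
  rw [← f0_integral a t ha hat hc, ← intervalIntegral.integral_const_mul]
  unfold xaFun
  exact ⟨intervalIntegral.integral_mono_on_of_le_Ioo hat.le i0 i2 (fun x hx => (hb x hx).1),
    intervalIntegral.integral_mono_on_of_le_Ioo hat.le i2 i1 (fun x hx => (hb x hx).2)⟩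

lemma FF_deriv (a : ℝ) (ha : 0 < a) (ha1 : a < 1) : HasDerivAt (FF a) (gFun a) 1 := by
  have hp : 0 < (1:ℝ) ^ 2 - a ^ 2 := by nlinarith
  have hr : 0 < Real.sqrt ((1:ℝ) ^ 2 - a ^ 2) := Real.sqrt_pos.2 hp
  have d0 : HasDerivAt (fun y : ℝ => y ^ 2 - a ^ 2) 2 1 := by
    simpa using ((hasDerivAt_id (1:ℝ)).pow 2).sub_const (a ^ 2)
  have d1 := d0.sqrt hp.ne'
  have htr : (1:ℝ) + Real.sqrt ((1:ℝ) ^ 2 - a ^ 2) ≠ 0 := by positivity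
  have d2 := (((hasDerivAt_id (1:ℝ)).add d1).log htr).sub_const (Real.log a)
  have d3 := d1.add (((hasDerivAt_id (1:ℝ)).const_sub 1).mul d2)
  refine d3.congr_deriv ?_
  unfold gFun
  rw [one_pow] at *
  rw [Real.log_div htr ha.ne']
  simp
  field_simp
  ring

lemma KK_deriv (a : ℝ) (ha : 0 < a) :
    HasDerivAt (fun t : ℝ => 1 / Real.sqrt (1 - (1 - t) ^ 2 / a ^ 2)) 0 1 := by
  have d0 : HasDerivAt (fun t : ℝ => 1 - (1 - t) ^ 2 / a ^ 2) 0 1 := by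
    simpa using (((((hasDerivAt_id (1:ℝ)).const_sub 1).pow 2).div_const (a ^ 2)).const_sub 1)
  have d1 := d0.sqrt (by simp)
  have d2 := d1.inv (by simp)
  simp only [one_div]
  exact d2.congr_deriv (by simp)

lemma ev_of_neg (f : ℝ → ℝ) (f' : ℝ) (h : HasDerivAt f f' 1) (hf : f' < 0) :
    ∃ δ > 0, ∀ t, |t - 1| < δ → (t < 1 → f 1 < f t) ∧ (1 < t → f t < f 1) := by
  have h1 := (hasDerivAt_iff_tendsto_slope.1 h).eventually_lt_const hf
  rw [eventually_nhdsWithin_iff, Metric.eventually_nhds_iff] at h1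
  obtain ⟨δ, hδ, H⟩ := h1
  refine ⟨δ, hδ, fun t ht => ⟨fun h2 => ?_, fun h2 => ?_⟩⟩
  · have := H (y := t) (by rwa [Real.dist_eq]) h2.ne
    rw [slope_def_field, div_neg_iff] at this
    rcases this with h | h <;> linarith
  · have := H (y := t) (by rwa [Real.dist_eq]) h2.ne'
    rw [slope_def_field, div_neg_iff] at this
    rcases this with h | h <;> linarith

/-- For `0 < a < a₀` (where `a₀` is the zero of `g`) there is `η > 0` with
`η < min(a,1−a)` such that `x_a(t) > √(1−a²)` for `1−η ≤ t < 1` and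
`x_a(t) < √(1−a²)` for `1 < t ≤ 1+η`. -/
theorem xa_comparison_below_a0 (a₀ a : ℝ) (h₀ : a₀ ∈ Set.Ioo (0:ℝ) 1)
    (hz : gFun a₀ = 0) (ha0 : 0 < a) (ha : a < a₀) :
    ∃ η > 0, η < min a (1 - a) ∧
      (∀ t : ℝ, 1 - η ≤ t → t < 1 → Real.sqrt (1 - a ^ 2) < xaFun a t) ∧
      (∀ t : ℝ, 1 < t → t ≤ 1 + η → xaFun a t < Real.sqrt (1 - a ^ 2)) := by
  have hg := g_neg a₀ a h₀ hz ha0 ha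
  have ha1 : a < 1 := ha.trans h₀.2
  have dF := FF_deriv a ha0 ha1
  have dG := (KK_deriv a ha0).mul dF
  obtain ⟨δ₁, hδ₁, H1⟩ := ev_of_neg _ _ dF hg
  obtain ⟨δ₂, hδ₂, H2⟩ := ev_of_neg _ _ dG (by simpa using hg)
  have hF1 : FF a 1 = Real.sqrt (1 - a ^ 2) := by simp [FF]
  obtain ⟨η, hη, hlt⟩ : ∃ η > 0, η < min (min δ₁ δ₂) (min (a ^ 2 / 4) (min a (1 - a))) := by
    apply exists_between
    have : 0 < 1 - a := by linarith
    positivity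
  simp only [lt_min_iff] at hlt
  obtain ⟨⟨l1, l2⟩, l3, l4, l5⟩ := hlt
  refine ⟨η, hη, lt_min l4 l5, fun t h1 h2 => ?_, fun t h1 h2 => ?_⟩
  · have hb := xa_bounds a t ha0 (by linarith) (by nlinarith) (by nlinarith)
    have := (H1 t (by rw [abs_lt]; constructor <;> linarith)).1 h2
    linarith [hb.1]
  · have hb := xa_bounds a t ha0 (by linarith) (by nlinarith) (by nlinarith)
    have := (H2 t (by rw [abs_lt]; constructor <;> linarith)).2 h1
    simp only [Pi.mul_apply, sub_self, hF1] at this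
    norm_num at this hb
    linarith [hb.2]
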